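/- arXiv:1903.09657 — 3 statements merged into one kernel-verified Lean document; each statement's English description precedes it below -/
import Mathlib

section
/- Let a, b > 0 and let R be the boundary of the rectangle with center at the origin and sides of lengths 2a and 2b parallel to the coordinate axes, i.e., R = {(x,y) ∈ ℝ² : max(|x|/a, |y|/b) = 1}. Let d_1 and d_2 be the diagonal lines of the rectangle, d_1 = {(x,y) : bx − ay = 0} and d_2 = {(x,y) : bx + ay = 0}. Then for every point P ∈ R, dist(P, d_1) + dist(P, d_2) = 2ab/√(a² + b²), where dist denotes Euclidean distance from a point to a line. Hence every rectangle is a (v_1,v_2)-taxicab circle with the same center and radius 2ab/√(a²+b²), for λ_1 = λ_2 = 1 and unit vectors v_1, v_2 perpendicular to the diagonals. -/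
theorem abs_sub_add_abs_add_eq_two_mul_max (u v : ℝ) :
    |u - v| + |u + v| = 2 * max |u| |v| := by
  grind

theorem rectangle_is_taxicab_circle (a b : ℝ) (ha : 0 < a) (hb : 0 < b)
    (P : ℝ × ℝ) (hP : max (|P.1| / a) (|P.2| / b) = 1) :
    |b * P.1 - a * P.2| / Real.sqrt (b ^ 2 + a ^ 2) +
      |b * P.1 + a * P.2| / Real.sqrt (b ^ 2 + a ^ 2) =
    2 * a * b / Real.sqrt (a ^ 2 + b ^ 2) := by
  have hmax : max |b * P.1| |a * P.2| = a * b := by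
    have h := mul_max_of_nonneg (|P.1| / a) (|P.2| / b) (mul_pos ha hb).le
    rw [hP, mul_one] at h
    rw [h, abs_mul, abs_mul, abs_of_pos ha, abs_of_pos hb]
    congr 1 <;> field_simp
  rw [← add_div, abs_sub_add_abs_add_eq_two_mul_max, hmax, add_comm (b ^ 2), mul_assoc]
end

section
/- Let a, b > 0, let E = {(x,y) ∈ ℝ² : x²/a² + y²/b² = 1}, let l_1 = {(x,y) : bx − ay = 0} and l_2 = {(x,y) : bx + ay = 0}, and set r = √2·ab/√(a² + b²) and R = √((a² + b²)/2). Then every point Q_1 ∈ E ∩ l_1 satisfies ‖Q_1‖ = R (Euclidean distance from the center) and dist(Q_1, l_2) = r, and moreover R·r = ab. -/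
theorem eccentric_radius_properties (a b : ℝ) (ha : 0 < a) (hb : 0 < b)
    (r R : ℝ) (hr : r = Real.sqrt 2 * a * b / Real.sqrt (a ^ 2 + b ^ 2))
    (hR : R = Real.sqrt ((a ^ 2 + b ^ 2) / 2))
    (Q : ℝ × ℝ)
    (hQE : Q.1 ^ 2 / a ^ 2 + Q.2 ^ 2 / b ^ 2 = 1) (hQl : b * Q.1 - a * Q.2 = 0) :
    Real.sqrt (Q.1 ^ 2 + Q.2 ^ 2) = R ∧
    |b * Q.1 + a * Q.2| / Real.sqrt (b ^ 2 + a ^ 2) = r ∧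
    R * r = a * b := by
  have hy : Q.2 = b * Q.1 / a := by
    rw [eq_div_iff ha.ne']
    linarith
  have hx2 : Q.1 ^ 2 = a ^ 2 / 2 := by
    rw [hy] at hQE
    field_simp at hQE
    linarith
  have hy2 : Q.2 ^ 2 = b ^ 2 / 2 := by
    rw [hy, div_pow, mul_pow, hx2]
    field_simp
  have hs : 0 < Real.sqrt (a ^ 2 + b ^ 2) := Real.sqrt_pos.mpr (by positivity)
  refine ⟨?_, ?_, ?_⟩
  · rw [hR, hx2, hy2, add_div]
  · have h_abs : |b * Q.1 + a * Q.2| = Real.sqrt 2 * a * b := by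
      rw [← abs_of_pos (show 0 < Real.sqrt 2 * a * b by positivity), ← sq_eq_sq_iff_abs_eq_abs]
      have h_sq : Real.sqrt 2 ^ 2 = 2 := Real.sq_sqrt (by norm_num)
      have h_lin : a * Q.2 = b * Q.1 := by linarith
      rw [h_lin, mul_pow, mul_pow, h_sq]
      linear_combination 4 * b ^ 2 * hx2
    rw [h_abs, hr, add_comm (b ^ 2)]
  · rw [hR, hr, Real.sqrt_div (by positivity)]
    field_simp
end

section
/- Let c > 0 and let l_1, l_2 be two distinct lines through a point C in ℝ² with unit normal vectors v_1, v_2, and let θ ∈ (0, π/2] be the non-obtuse angle between l_1 and l_2, so cos θ = |⟨v_1, v_2⟩|. Then the set {P ∈ ℝ² : dist(P, l_1)² + dist(P, l_2)² = c} is an ellipse centered at C with semi-major axis a = √c/√(1 − cos θ) and semi-minor axis b = √c/√(1 + cos θ), whose major axis lies along the bisector of the non-obtuse angle between l_1 and l_2; concretely, there is an isometry of ℝ² taking this set onto {(x,y) : x²/a² + y²/b² = 1}. -/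
open scoped RealInnerProductSpace

/-- Two orthogonal nonzero vectors of the plane are, up to scaling by their norms, the axes of
some orthonormal coordinate system. -/
lemma exists_orthonormalBasis_norm_mul_eq_inner {u w : EuclideanSpace ℝ (Fin 2)}
    (hu : u ≠ 0) (hw : w ≠ 0) (huw : ⟪u, w⟫ = 0) :
    ∃ e : OrthonormalBasis (Fin 2) ℝ (EuclideanSpace ℝ (Fin 2)),
      ∀ x, ‖u‖ * e.repr x 0 = ⟪u, x⟫ ∧ ‖w‖ * e.repr x 1 = ⟪w, x⟫ := by
  have hu' : ‖u‖ ≠ 0 := norm_ne_zero_iff.mpr hu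
  have hw' : ‖w‖ ≠ 0 := norm_ne_zero_iff.mpr hw
  have hon : Orthonormal ℝ ![‖u‖⁻¹ • u, ‖w‖⁻¹ • w] := by
    rw [orthonormal_vecCons_iff]
    refine ⟨by simp [norm_smul, hu'], ?_, ?_⟩
    · simp [inner_smul_left, inner_smul_right, huw]
    · rw [orthonormal_vecCons_iff]
      refine ⟨by simp [norm_smul, hw'], fun i => i.elim0, fun i => i.elim0, fun i => i.elim0⟩
  obtain ⟨e, he⟩ := Orthonormal.exists_orthonormalBasis_extension_of_card_eq
    (ι := Fin 2) (by simp) (s := Set.univ) (hon.comp _ Subtype.val_injective)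
  refine ⟨e, fun x => ⟨?_, ?_⟩⟩
  · rw [e.repr_apply_apply, he 0 (Set.mem_univ _)]
    simp [inner_smul_left, hu']
  · rw [e.repr_apply_apply, he 1 (Set.mem_univ _)]
    simp [inner_smul_left, hw']

/-- In coordinates along `v - w` and `v + w`, the sum of the squared inner products with two
unit vectors `v`, `w` is diagonal. -/
lemma exists_orthonormalBasis_inner_sq_add_inner_sq {v w : EuclideanSpace ℝ (Fin 2)}
    (hv : ‖v‖ = 1) (hw : ‖w‖ = 1) (hsub : v ≠ w) (hadd : v ≠ -w) :
    ∃ e : OrthonormalBasis (Fin 2) ℝ (EuclideanSpace ℝ (Fin 2)), ∀ x,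
      ⟪v, x⟫ ^ 2 + ⟪w, x⟫ ^ 2
        = (1 - ⟪v, w⟫) * e.repr x 0 ^ 2 + (1 + ⟪v, w⟫) * e.repr x 1 ^ 2 := by
  obtain ⟨e, he⟩ := exists_orthonormalBasis_norm_mul_eq_inner (u := v - w) (w := v + w)
    (sub_ne_zero.mpr hsub) (fun h => hadd (eq_neg_of_add_eq_zero_left h))
    (by rw [real_inner_comm, real_inner_add_sub_eq_zero_iff, hv, hw])
  refine ⟨e, fun x => ?_⟩
  obtain ⟨hx0, hx1⟩ := he x
  rw [inner_sub_left] at hx0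
  rw [inner_add_left] at hx1
  have hs : ‖v - w‖ ^ 2 = 2 * (1 - ⟪v, w⟫) := by
    rw [norm_sub_sq_real, hv, hw]; ring
  have ha : ‖v + w‖ ^ 2 = 2 * (1 + ⟪v, w⟫) := by
    rw [norm_add_sq_real, hv, hw]; ring
  have h0 := congrArg (· ^ 2) hx0
  have h1 := congrArg (· ^ 2) hx1
  simp only [mul_pow, hs, ha] at h0 h1
  linarith

theorem two_eccentrices_set_is_ellipse (c : ℝ) (hc : 0 < c)
    (C v1 v2 : EuclideanSpace ℝ (Fin 2))
    (h1 : ‖v1‖ = 1) (h2 : ‖v2‖ = 1)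
    (hlines : v1 ≠ v2 ∧ v1 ≠ -v2)
    (a b : ℝ)
    (ha : a = Real.sqrt c / Real.sqrt (1 - |⟪v1, v2⟫|))
    (hb : b = Real.sqrt c / Real.sqrt (1 + |⟪v1, v2⟫|)) :
    ∃ f : EuclideanSpace ℝ (Fin 2) ≃ᵢ EuclideanSpace ℝ (Fin 2),
      f C = 0 ∧
      f '' {P : EuclideanSpace ℝ (Fin 2) |
              ⟪v1, P - C⟫ ^ 2 + ⟪v2, P - C⟫ ^ 2 = c}
        = {Q : EuclideanSpace ℝ (Fin 2) |
              (Q 0) ^ 2 / a ^ 2 + (Q 1) ^ 2 / b ^ 2 = 1} := by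
  obtain ⟨e, he⟩ : ∃ e : OrthonormalBasis (Fin 2) ℝ (EuclideanSpace ℝ (Fin 2)), ∀ x,
      ⟪v1, x⟫ ^ 2 + ⟪v2, x⟫ ^ 2
        = (1 - |⟪v1, v2⟫|) * e.repr x 0 ^ 2 + (1 + |⟪v1, v2⟫|) * e.repr x 1 ^ 2 := by
    rcases le_total 0 ⟪v1, v2⟫ with h | h
    · rw [abs_of_nonneg h]
      exact exists_orthonormalBasis_inner_sq_add_inner_sq h1 h2 hlines.1 hlines.2
    · rw [abs_of_nonpos h]
      simpa [inner_neg_left, inner_neg_right] using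
        exists_orthonormalBasis_inner_sq_add_inner_sq h1 ((norm_neg v2).trans h2) hlines.2
          (by simpa using hlines.1)
  have hle : |⟪v1, v2⟫| ≤ 1 := by simpa [h1, h2] using abs_real_inner_le_norm v1 v2
  have ha2 : a ^ 2 = c / (1 - |⟪v1, v2⟫|) := by
    rw [ha, div_pow, Real.sq_sqrt hc.le, Real.sq_sqrt (by linarith)]
  have hb2 : b ^ 2 = c / (1 + |⟪v1, v2⟫|) := by
    rw [hb, div_pow, Real.sq_sqrt hc.le, Real.sq_sqrt (by positivity)]
  refine ⟨(IsometryEquiv.subRight C).trans e.repr.toIsometryEquiv, by simp, ?_⟩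
  rw [← IsometryEquiv.preimage_symm]
  ext Q
  have hQ := he (e.repr.symm Q)
  rw [e.repr.apply_symm_apply] at hQ
  have hsub : ((IsometryEquiv.subRight C).trans e.repr.toIsometryEquiv).symm Q - C
      = e.repr.symm Q := by
    simp [IsometryEquiv.symm_trans_apply]
  simp only [Set.mem_preimage, Set.mem_ofPred_eq, hsub, hQ, ha2, hb2, div_div_eq_mul_div,
    ← add_div, div_eq_one_iff_eq hc.ne', mul_comm]
end
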